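/- arXiv:1201.3842 — 2 statements merged into one kernel-verified Lean document; each statement's English description precedes it below -/
import Mathlib

section
/- Let a and b be positive integers with a ≤ b and b < 2a. Then 3b² − 2ab + 5b − 2a + 4 ≤ T(a,b;2) ≤ 4a(b³ + 2b² + 2b) − 4b². That is, every 2-coloring of {1, ..., 4a(b³ + 2b² + 2b) − 4b²} contains a monochromatic (a,b)-triple, and there exists a 2-coloring of {1, ..., 3b² − 2ab + 5b − 2a + 3} with no monochromatic (a,b)-triple. -/
theorem fin2_aux {p q r : Fin 2} (h1 : p ≠ r) (h2 : q ≠ r) : p = q := by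
  omega

/-- Existence of an even point `x ≤ 2b+2` where the colour changes between `x` and `x+2`. -/
theorem change_aux (a b M : ℕ) (hab : a ≤ b) (hM : 2 * b + 4 ≤ M) (χ : ℕ → Fin 2)
    (H : ∀ x d : ℕ, 0 < x → 0 < d → b*x + 2*d ≤ M → ¬(χ (a*x + d) = χ x ∧ χ (b*x + 2*d) = χ x)) :
    ∃ x, 2 ≤ x ∧ x ≤ 2 * b + 2 ∧ χ (x + 2) ≠ χ x := by
  by_contra hc
  push Not at hc
  have key : ∀ n, n ≤ b + 1 → χ (2 + 2 * n) = χ 2 := by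
    intro n
    induction n with
    | zero => intro _; rfl
    | succ k ih =>
      intro hk
      have h1 := hc (2 + 2 * k) (by omega) (by omega)
      rw [← ih (by omega), ← h1]
      congr 1
  have h1 := key a (by omega)
  have h2 := key (b + 1) le_rfl
  refine H 2 2 (by omega) (by omega) (by omega) ⟨?_, ?_⟩
  · rw [← h1]; congr 1; ring
  · rw [← h2]; congr 1; ring

theorem upper_aux (a b c M : ℕ) (ha : 0 < a) (hc : 0 < c) (hab : a ≤ b) (hord : b + c = 2 * a)
    (hM : M = 4*a*b^3 + 8*a*b^2 + 4*b*c) (χ : ℕ → Fin 2)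
    (H : ∀ x d : ℕ, 0 < x → 0 < d → b*x + 2*d ≤ M → ¬(χ (a*x + d) = χ x ∧ χ (b*x + 2*d) = χ x)) :
    False := by
  have hb1 : 1 ≤ b := by omega
  have hca : c ≤ a := by omega
  have e2 : 1 ≤ b ^ 2 := Nat.one_le_pow _ _ hb1
  have e3 : b ^ 2 ≤ b ^ 3 := Nat.pow_le_pow_right hb1 (by omega)
  have f1 : a * 1 ≤ a * b ^ 2 := Nat.mul_le_mul_left a e2
  have f2 : a * b ^ 2 ≤ a * b ^ 3 := Nat.mul_le_mul_left a e3
  have f3 : b * 1 ≤ b * c := Nat.mul_le_mul_left b hc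
  have hM1 : 2 * b + 4 ≤ M := by subst hM; nlinarith
  obtain ⟨x, hx2, hxb, hne⟩ := change_aux a b M hab hM1 χ H
  have H' : ∀ x y z : ℕ, 0 < x → a * x < y → z + c * x = 2 * y → z ≤ M →
      χ y = χ x → χ z = χ x → False := by
    intro x y z hx hy hz hzM h1 h2
    obtain ⟨d, rfl⟩ := Nat.exists_eq_add_of_lt hy
    have hzz : z = b * x + 2 * (d + 1) := by
      have : (b + c) * x = 2 * a * x := by rw [hord]
      nlinarith
    subst hzz
    exact H x (d + 1) hx (by omega) hzM ⟨by rw [← h1]; rfl, h2⟩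
  have step : ∀ y, a * x + b < y → 2 * y ≤ M + c * x → χ y = χ x → χ (y + c) = χ x := by
    intro y hy hyM h1
    have hcx : c * x ≤ a * x := Nat.mul_le_mul_right x hca
    obtain ⟨z, hz⟩ : ∃ z, z + c * x = 2 * y := ⟨2 * y - c * x, by omega⟩
    have hzM : z ≤ M := by omega
    by_contra h2
    have hzx : χ z ≠ χ x := fun h => H' x y z (by omega) (by omega) hz hzM h1 h
    refine H' (x + 2) (y + c) z (by omega) ?_ ?_ hzM (fin2_aux h2 hne) (fin2_aux hzx hne)
    · rw [Nat.mul_add]; omega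
    · rw [Nat.mul_add]; omega
  obtain ⟨m, hm1, hm2⟩ : ∃ m, a * x + b < c * m ∧ c * m ≤ a * x + 2 * a := by
    refine ⟨(a * x + b) / c + 1, ?_, ?_⟩
    · exact Nat.lt_mul_div_succ _ hc
    · have := Nat.mul_div_le (a * x + b) c
      rw [Nat.mul_add]; omega
  have hmpos : 0 < m := by
    rcases Nat.eq_zero_or_pos m with h | h
    · subst h; omega
    · exact h
  have hax : a * x ≤ a * (2 * b + 2) := Nat.mul_le_mul_left a hxb
  have hcx2 : c * 2 ≤ c * x := Nat.mul_le_mul_left c hx2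
  have hcm : c * m ≤ 2 * a * b + 4 * a := by nlinarith
  have hT : 2 * (c * (b * (b * m + 2) + 2)) ≤ M + 4 * c := by
    have : b ^ 2 * (c * m) ≤ b ^ 2 * (2 * a * b + 4 * a) := Nat.mul_le_mul_left _ hcm
    subst hM
    nlinarith
  have hTM : c * (b * (b * m + 2) + 2) ≤ M := by subst hM; nlinarith
  have mono : ∀ n j, m ≤ j → j + n ≤ b * (b * m + 2) + 2 → χ (c * j) = χ x →
      χ (c * (j + n)) = χ x := by
    intro n
    induction n with
    | zero => intro j _ _ h; exact h
    | succ k ih =>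
      intro j hj hjn h
      have h1 := ih j hj (by omega) h
      have g1 : c * m ≤ c * (j + k) := Nat.mul_le_mul_left c (by omega)
      have g2 : c * (j + (k + 1)) ≤ c * (b * (b * m + 2) + 2) := Nat.mul_le_mul_left c hjn
      have g3 : c * (j + (k + 1)) = c * (j + k) + c := by ring
      rw [g3]
      exact step _ (by omega) (by omega) h1
  have tri : ∀ j, 0 < j → j ≤ b * m + 2 → χ (c * (a * j + 1)) = χ (c * j) →
      χ (c * (b * j + 2)) = χ (c * j) → False := by
    intro j hj hjb h1 h2
    have g : b * j ≤ b * (b * m + 2) := Nat.mul_le_mul_left b hjb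
    have g' : c * (b * j + 2) ≤ c * (b * (b * m + 2) + 2) := Nat.mul_le_mul_left c (by omega)
    have i1 : a * (c * j) + c = c * (a * j + 1) := by ring
    have i2 : b * (c * j) + 2 * c = c * (b * j + 2) := by ring
    refine H (c * j) c (Nat.mul_pos hc hj) hc (by omega) ?_
    rw [i1, i2]
    exact ⟨h1, h2⟩
  have red : ∀ j, m ≤ j → j ≤ b * m + 2 → χ (c * j) = χ x → False := by
    intro j hj hjb h
    have g : b * j ≤ b * (b * m + 2) := Nat.mul_le_mul_left b hjb
    have g1 : 1 * j ≤ a * j := Nat.mul_le_mul_right j ha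
    have g2 : a * j ≤ b * j := Nat.mul_le_mul_right j hab
    have h1 := mono (a * j + 1 - j) j hj (by omega) h
    have h2 := mono (b * j + 2 - j) j hj (by omega) h
    rw [show j + (a * j + 1 - j) = a * j + 1 by omega] at h1
    rw [show j + (b * j + 2 - j) = b * j + 2 by omega] at h2
    exact tri j (by omega) hjb (h1.trans h.symm) (h2.trans h.symm)
  have k1 : 1 * m ≤ a * m := Nat.mul_le_mul_right m ha
  have k2 : a * m ≤ b * m := Nat.mul_le_mul_right m hab
  have n0 : χ (c * m) ≠ χ x := red m le_rfl (by omega)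
  have n1 : χ (c * (a * m + 1)) ≠ χ x := red _ (by omega) (by omega)
  have n2 : χ (c * (b * m + 2)) ≠ χ x := red _ (by omega) (by omega)
  exact tri m hmpos (by omega) (fin2_aux n1 n0) (fin2_aux n2 n0)

theorem lower_aux (a b c : ℕ) (hb2 : 2 ≤ b) (hc : 0 < c) (hab : a ≤ b) (ha : 0 < a)
    (hord : b + c = 2 * a) (x d : ℕ) (hx : 0 < x) (hd : 0 < d) (N : ℕ)
    (hN : N + c * (b + 1) = 2 * (b^2 + 2 * b + 2) - 1) (hz : b*x + 2*d ≤ N) (χ : ℕ → Fin 2)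
    (hχ : ∀ n, χ n = if b + 2 ≤ n ∧ n ≤ b^2 + 2*b + 1 then 1 else 0)  :
    ¬(χ (a*x + d) = χ x ∧ χ (b*x + 2*d) = χ x) := by
  rintro ⟨h1, h2⟩
  have hc1 : 1 * (b + 1) ≤ c * (b + 1) := Nat.mul_le_mul_right _ hc
  have hbx : b * 1 ≤ b * x := Nat.mul_le_mul_left b hx
  have hax : 1 * x ≤ a * x := Nat.mul_le_mul_right x ha
  have habx : a * x ≤ b * x := Nat.mul_le_mul_right x hab
  have hcx : c * x + b * x = 2 * (a * x) := by
    have : (b + c) * x = 2 * a * x := by rw [hord]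
    nlinarith
  have hbb : 2 * b ≤ b ^ 2 := by nlinarith
  rcases Nat.lt_or_ge x (b + 2) with hx1 | hx1
  · have hxc : χ x = 0 := by rw [hχ, if_neg]; omega
    rw [hxc, hχ] at h1 h2
    have h1' : ¬ (b + 2 ≤ a*x + d ∧ a*x+d ≤ b^2+2*b+1) := by
      intro h; rw [if_pos h] at h1; exact absurd h1 (by decide)
    have h2' : ¬ (b + 2 ≤ b*x + 2*d ∧ b*x+2*d ≤ b^2+2*b+1) := by
      intro h; rw [if_pos h] at h2; exact absurd h2 (by decide)
    have hcxb : c * x ≤ c * (b + 1) := Nat.mul_le_mul_left c (by omega)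
    omega
  · have hbx2 : b * (b + 2) ≤ b * x := Nat.mul_le_mul_left b hx1
    rcases Nat.lt_or_ge x (b^2 + 2*b + 2) with hx2 | hx2
    · have hxc : χ x = 1 := by rw [hχ, if_pos]; omega
      rw [hxc, hχ] at h2
      have h2' : (b + 2 ≤ b*x + 2*d ∧ b*x+2*d ≤ b^2+2*b+1) := by
        by_contra h; rw [if_neg h] at h2; exact absurd h2 (by decide)
      nlinarith
    · have : 2 * x ≤ b * x := Nat.mul_le_mul_right x hb2
      omega

theorem stmt_10 (a b : ℕ) (ha : 0 < a) (hb : 0 < b) (hab : a ≤ b) (hord : b < 2*a) :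
    (∀ χ : ℕ → Fin 2, ∃ x d : ℕ, 0 < x ∧ 0 < d ∧ b*x + 2*d ≤ 4*a*(b^3 + 2*b^2 + 2*b) - 4*b^2 ∧ χ (a*x + d) = χ x ∧ χ (b*x + 2*d) = χ x) ∧
    (∃ χ : ℕ → Fin 2, ∀ x d : ℕ, 0 < x → 0 < d → b*x + 2*d ≤ 3*b^2 - 2*a*b + 5*b - 2*a + 3 → ¬(χ (a*x + d) = χ x ∧ χ (b*x + 2*d) = χ x)) := by
  obtain ⟨c, hc⟩ : ∃ c, b + c = 2 * a := ⟨2 * a - b, by omega⟩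
  constructor
  · intro χ
    by_contra hcon
    push Not at hcon
    refine upper_aux a b c _ ha (by omega) hab hc rfl χ ?_
    intro x d hx hd hle hh
    refine hcon x d hx hd (hle.trans ?_) hh.1 hh.2
    apply Nat.le_sub_of_add_le
    have : (b + c) * b = 2 * a * b := by rw [hc]
    nlinarith
  · rcases Nat.lt_or_ge b 2 with h | hb2
    · obtain rfl : b = 1 := by omega
      obtain rfl : a = 1 := by omega
      refine ⟨fun n => if n = 3 ∨ n = 4 ∨ n = 7 then 1 else 0, ?_⟩
      intro x d hx hd hle
      have hx7 : x ≤ 7 := by omega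
      have hd7 : d ≤ 3 := by omega
      interval_cases x <;> interval_cases d <;> first | omega | decide
    · refine ⟨fun n => if b + 2 ≤ n ∧ n ≤ b^2 + 2*b + 1 then 1 else 0, ?_⟩
      intro x d hx hd hle
      refine lower_aux a b c hb2 (by omega) hab ha hc x d hx hd _ ?_ hle _ (fun n => rfl)
      have e1 : 2 * a * b ≤ 3 * b ^ 2 := by nlinarith
      have e2 : (b + c) * b = 2 * a * b := by rw [hc]
      have e3 : (b + c) * b = b ^ 2 + c * b := by ring
      have e4 : c * (b + 1) = c * b + c := by ring
      omega
end

section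
/- T(6,7;2) = 120; that is, 120 is the least positive integer n such that every 2-coloring of {1,...,n} contains positive integers x, d with x, 6x + d, and 7x + 2d all the same color: every 2-coloring of {1,...,120} contains such a monochromatic triple, and some 2-coloring of {1,...,119} contains none. -/
/-- A refutation tree: `L x d` is a monochromatic triple, `N v l r` branches on the colour of `v`. -/
inductive RefTree where
  | L (x d : ℕ) : RefTree
  | N (v : ℕ) (l r : RefTree) : RefTree

namespace RefTree

/-- `p`, `q` are bit masks of the numbers known to have colour `0` resp. `1`. -/
def check : RefTree → ℕ → ℕ → Bool
  | L x d, p, q =>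
    Nat.blt 0 x && Nat.blt 0 d && Nat.ble (7 * x + 2 * d) 120 &&
      ((p.testBit x && p.testBit (6 * x + d) && p.testBit (7 * x + 2 * d)) ||
       (q.testBit x && q.testBit (6 * x + d) && q.testBit (7 * x + 2 * d)))
  | N v l r, p, q => check l (p ||| 2 ^ v) q && check r p (q ||| 2 ^ v)

theorem check_sound (χ : ℕ → Fin 2) (t : RefTree) : ∀ p q : ℕ, t.check p q = true →
    (∀ i, p.testBit i = true → χ i = 0) → (∀ i, q.testBit i = true → χ i = 1) →
    ∃ x d : ℕ, 0 < x ∧ 0 < d ∧ 7*x + 2*d ≤ 120 ∧ χ (6*x + d) = χ x ∧ χ (7*x + 2*d) = χ x := by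
  induction t with
  | L x d =>
    intro p q h hp hq
    simp only [check, Bool.and_eq_true, Bool.or_eq_true, Nat.blt_eq, Nat.ble_eq] at h
    obtain ⟨⟨⟨hx, hd⟩, hle⟩, h⟩ := h
    refine ⟨x, d, hx, hd, hle, ?_⟩
    rcases h with ⟨⟨h1, h2⟩, h3⟩ | ⟨⟨h1, h2⟩, h3⟩
    · rw [hp _ h1, hp _ h2, hp _ h3]; exact ⟨rfl, rfl⟩
    · rw [hq _ h1, hq _ h2, hq _ h3]; exact ⟨rfl, rfl⟩
  | N v l r ihl ihr =>
    intro p q h hp hq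
    simp only [check, Bool.and_eq_true] at h
    have hv : χ v = 0 ∨ χ v = 1 := by omega
    rcases hv with hv | hv
    · refine ihl _ _ h.1 (fun i hi => ?_) hq
      simp only [Nat.testBit_or, Nat.testBit_two_pow, Bool.or_eq_true, decide_eq_true_eq] at hi
      rcases hi with hi | rfl
      · exact hp i hi
      · exact hv
    · refine ihr _ _ h.2 hp (fun i hi => ?_)
      simp only [Nat.testBit_or, Nat.testBit_two_pow, Bool.or_eq_true, decide_eq_true_eq] at hi
      rcases hi with hi | rfl
      · exact hq i hi
      · exact hv

set_option maxRecDepth 100000 in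
/-- The refutation tree for `n = 120`. -/
def cert : RefTree :=
  (N 1 (N 2 (N 3 (N 35 (N 65 (L 1 29) (N 60 (L 2 23) (N 55 (L 3 17) (N 9 (N 7 (L 1 1) (N 45 (N
  85 (L 1 39) (L 7 18)) (L 7 3))) (L 9 1))))) (N 4 (N 50 (N 95 (L 1 44) (N 85 (L 3 32) (N 80 (L
  4 26) (N 13 (N 9 (L 1 3) (N 65 (N 115 (L 3 47) (L 9 26)) (L 9 11))) (L 13 2))))) (N 65 (N 120
  (L 2 53) (N 40 (L 3 22) (N 115 (L 3 47) (N 6 (N 100 (L 6 29) (N 16 (N 13 (L 2 1) (N 90 (N 60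
  (L 6 24) (N 8 (L 8 17) (L 8 2))) (L 13 12))) (L 16 4))) (L 6 4))))) (N 7 (N 9 (L 1 1) (N 55 (N
  85 (N 105 (L 1 49) (N 5 (L 5 25) (L 5 35))) (L 9 11)) (L 9 1))) (L 7 8)))) (N 50 (N 30 (L 2
  18) (N 25 (N 40 (L 2 13) (L 4 6)) (L 4 1))) (L 4 11)))) (N 20 (N 35 (L 1 14) (N 30 (L 2 8) (N
  25 (N 45 (L 1 19) (L 3 12)) (L 3 7)))) (N 25 (N 45 (L 1 19) (N 40 (L 2 13) (N 30 (N 65 (N 55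
  (L 1 24) (N 35 (L 1 29) (L 3 17))) (L 3 22)) (L 3 12)))) (L 3 2)))) (N 25 (N 15 (L 1 9) (N 45
  (L 1 19) (N 20 (N 35 (L 1 14) (N 3 (L 3 2) (N 55 (N 30 (L 1 24) (L 3 12)) (L 3 17)))) (L 2
  3)))) (N 40 (N 75 (L 1 34) (N 4 (N 30 (L 4 6) (N 60 (L 4 16) (N 20 (N 35 (L 1 14) (L 2 23)) (L
  2 8)))) (N 30 (N 55 (L 1 24) (N 7 (N 9 (L 1 1) (N 65 (N 35 (L 1 29) (N 3 (L 3 22) (L 3 7))) (L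
  9 1))) (L 7 13))) (L 4 1)))) (L 2 13)))) (N 2 (N 25 (N 40 (L 2 13) (N 75 (N 4 (N 30 (L 4 1) (N
  55 (N 7 (L 7 13) (N 9 (N 65 (L 9 1) (N 35 (N 3 (L 3 7) (L 3 22)) (L 1 29))) (L 1 1))) (L 1
  24))) (N 30 (N 60 (N 20 (L 2 8) (N 35 (L 2 23) (L 1 14))) (L 4 16)) (L 4 6))) (L 1 34))) (N 15
  (N 45 (N 20 (L 2 3) (N 35 (N 3 (N 55 (L 3 17) (N 30 (L 3 12) (L 1 24))) (L 3 2)) (L 1 14))) (L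
  1 19)) (L 1 9))) (N 3 (N 20 (N 25 (L 3 2) (N 45 (N 40 (N 30 (L 3 12) (N 65 (L 3 22) (N 55 (N
  35 (L 3 17) (L 1 29)) (L 1 24)))) (L 2 13)) (L 1 19))) (N 35 (N 30 (N 25 (L 3 7) (N 45 (L 3
  12) (L 1 19))) (L 2 8)) (L 1 14))) (N 35 (N 4 (N 50 (L 4 11) (N 30 (N 25 (L 4 1) (N 40 (L 4 6)
  (L 2 13))) (L 2 18))) (N 50 (N 65 (N 7 (L 7 8) (N 9 (N 55 (L 9 1) (N 85 (L 9 11) (N 105 (N 5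
  (L 5 35) (L 5 25)) (L 1 49)))) (L 1 1))) (N 120 (N 40 (N 115 (N 6 (L 6 4) (N 100 (N 16 (L 16
  4) (N 13 (N 90 (L 13 12) (N 60 (N 8 (L 8 2) (L 8 17)) (L 6 24))) (L 2 1))) (L 6 29))) (L 3
  47)) (L 3 22)) (L 2 53))) (N 95 (N 85 (N 80 (N 13 (L 13 2) (N 9 (N 65 (L 9 11) (N 115 (L 9 26)
  (L 3 47))) (L 1 3))) (L 4 26)) (L 3 32)) (L 1 44)))) (N 65 (N 60 (N 55 (N 9 (L 9 1) (N 7 (N 45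
  (L 7 3) (N 85 (L 7 18) (L 1 39))) (L 1 1))) (L 3 17)) (L 2 23)) (L 1 29))))))

theorem cert_check : cert.check 0 0 = true := by decide +kernel

end RefTree

/-- Bit mask of a colouring of `1..119` without monochromatic triple. -/
def goodMask : ℕ := 771809804005392623785266895072065790

theorem goodMask_spec : ∀ x : Fin 18, ∀ d : Fin 60, 0 < x.val ∧ 0 < d.val ∧ 7*x.val + 2*d.val ≤ 119 →
    ¬(goodMask.testBit (6*x.val + d.val) = goodMask.testBit x.val ∧
      goodMask.testBit (7*x.val + 2*d.val) = goodMask.testBit x.val) := by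
  decide +kernel

theorem stmt_18 :
    (∀ χ : ℕ → Fin 2, ∃ x d : ℕ, 0 < x ∧ 0 < d ∧ 7*x + 2*d ≤ 120 ∧ χ (6*x + d) = χ x ∧ χ (7*x + 2*d) = χ x) ∧
    (∃ χ : ℕ → Fin 2, ∀ x d : ℕ, 0 < x → 0 < d → 7*x + 2*d ≤ 119 → ¬(χ (6*x + d) = χ x ∧ χ (7*x + 2*d) = χ x)) := by
  refine ⟨fun χ => RefTree.check_sound χ RefTree.cert 0 0 RefTree.cert_check (by simp) (by simp), ?_⟩
  refine ⟨fun i => if goodMask.testBit i = true then 1 else 0, fun x d hx hd hle h => ?_⟩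
  have key : ∀ a b : Bool, (if a = true then (1 : Fin 2) else 0) = (if b = true then 1 else 0) → a = b := by
    decide
  exact goodMask_spec ⟨x, by omega⟩ ⟨d, by omega⟩ ⟨hx, hd, hle⟩ ⟨key _ _ h.1, key _ _ h.2⟩
end
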